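/- arXiv:0905.3419 — 2 statements merged into one kernel-verified Lean document; each statement's English description precedes it below -/
import Mathlib

section
/- For any density matrices ρ and σ on ℂⁿ, one has 1 − D(ρ,σ) ≤ Tr(√ρ √σ), where D(ρ,σ) = ½‖ρ − σ‖₁ is the trace distance (the Bhattacharyya bound). -/
open Matrix Complex Finset
open scoped ComplexOrder MatrixOrder

/-- The trace norm `‖A‖₁ = Tr √(Aᴴ A)`. -/
noncomputable def traceNorm {ι : Type*} [Fintype ι] [DecidableEq ι]
    (A : Matrix ι ι ℂ) : ℝ :=
  ((CFC.sqrt (Aᴴ * A)).trace).re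

/-- The trace distance `D(ρ,σ) = ½‖ρ − σ‖₁`. -/
noncomputable def traceDist {ι : Type*} [Fintype ι] [DecidableEq ι]
    (ρ σ : Matrix ι ι ℂ) : ℝ :=
  traceNorm (ρ - σ) / 2

section PowersStormer

variable {ι : Type*} [Fintype ι] [DecidableEq ι]

/-- The trace of a product of two positive semidefinite matrices is nonnegative. -/
lemma trace_mul_re_nonneg {A B : Matrix ι ι ℂ} (hA : 0 ≤ A) (hB : 0 ≤ B) :
    0 ≤ (A * B).trace.re := by
  have h := (nonneg_iff_posSemidef.1 hB).conjTranspose_mul_mul_same (CFC.sqrt A)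
  rw [(nonneg_iff_posSemidef.1 (CFC.sqrt_nonneg A)).isHermitian.eq] at h
  have htr := h.trace_nonneg
  rw [trace_mul_cycle, CFC.sqrt_mul_sqrt_self A hA] at htr
  exact (Complex.le_def.1 htr).1

/-- A Hermitian matrix `S` admits a sign: a Hermitian contraction `U` commuting with `S` such that
`U * S` dominates both `S` and `-S`. -/
lemma exists_sign {S : Matrix ι ι ℂ} (hS : IsSelfAdjoint S) :
    ∃ U : Matrix ι ι ℂ, 0 ≤ 1 - U ∧ 0 ≤ 1 + U ∧ U * S = S * U ∧
      0 ≤ U * S + S ∧ 0 ≤ U * S - S := by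
  have hcont (f : ℝ → ℝ) : ContinuousOn f (spectrum ℝ S) :=
    S.finite_real_spectrum.continuousOn f
  have hid : cfc (fun x : ℝ ↦ x) S = S := cfc_id' ℝ S
  have hmul : cfc Real.sign S * S = cfc (fun x ↦ Real.sign x * x) S := by
    rw [cfc_mul _ _ S (hcont _) (hcont _), hid]
  have hone : cfc (fun _ : ℝ ↦ (1 : ℝ)) S = 1 := cfc_const_one ℝ S
  refine ⟨cfc Real.sign S, ?_, ?_, ?_, ?_, ?_⟩
  · rw [← hone, ← cfc_sub _ _ S (hcont _) (hcont _)]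
    refine cfc_nonneg fun x _ ↦ ?_
    rcases Real.sign_apply_eq x with h | h | h <;> norm_num [h]
  · rw [← hone, ← cfc_add S _ _ (hcont _) (hcont _)]
    refine cfc_nonneg fun x _ ↦ ?_
    rcases Real.sign_apply_eq x with h | h | h <;> norm_num [h]
  · have h := cfc_commute_cfc Real.sign (fun x : ℝ ↦ x) S
    rw [hid] at h
    exact h
  · have h : cfc Real.sign S * S + S = cfc (fun x ↦ Real.sign x * x + x) S := by
      rw [cfc_add S _ _ (hcont _) (hcont _), hid, hmul]
    rw [h]
    refine cfc_nonneg fun x _ ↦ ?_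
    rcases lt_trichotomy x 0 with hx | rfl | hx
    · simp [Real.sign_of_neg hx]
    · simp
    · rw [Real.sign_of_pos hx]; linarith
  · have h : cfc Real.sign S * S - S = cfc (fun x ↦ Real.sign x * x - x) S := by
      rw [cfc_sub _ _ S (hcont _) (hcont _), hid, hmul]
    rw [h]
    refine cfc_nonneg fun x _ ↦ ?_
    rcases lt_trichotomy x 0 with hx | rfl | hx
    · rw [Real.sign_of_neg hx]; linarith
    · simp
    · simp [Real.sign_of_pos hx]

/-- For Hermitian `X` and `-1 ≤ U ≤ 1`, one has `Re Tr (U X) ≤ ‖X‖₁`. -/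
lemma trace_mul_re_le_traceNorm {U X : Matrix ι ι ℂ} (hX : IsSelfAdjoint X)
    (hU₁ : 0 ≤ 1 - U) (hU₂ : 0 ≤ 1 + U) : (U * X).trace.re ≤ traceNorm X := by
  have hadd : 0 ≤ CFC.abs X + X := by
    rw [CFC.abs_add_self X hX]
    exact nsmul_nonneg (CFC.posPart_nonneg X) 2
  have hsub : 0 ≤ CFC.abs X - X := by
    rw [CFC.abs_sub_self X hX]
    exact nsmul_nonneg (CFC.negPart_nonneg X) 2
  have h₁ := trace_mul_re_nonneg hU₁ hadd
  have h₂ := trace_mul_re_nonneg hU₂ hsub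
  change _ ≤ (CFC.abs X).trace.re
  simp only [mul_add, mul_sub, add_mul, sub_mul, one_mul, trace_add, trace_sub,
    Complex.add_re, Complex.sub_re] at h₁ h₂
  linarith

/-- The Powers–Størmer inequality `Tr (A - B)² ≤ ‖A² - B²‖₁` for positive semidefinite matrices. -/
lemma trace_sub_sq_re_le_traceNorm {A B : Matrix ι ι ℂ} (hA : 0 ≤ A) (hB : 0 ≤ B) :
    ((A - B) * (A - B)).trace.re ≤ traceNorm (A * A - B * B) := by
  have hAs := IsSelfAdjoint.of_nonneg hA
  have hBs := IsSelfAdjoint.of_nonneg hB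
  obtain ⟨U, hU₁, hU₂, hcomm, hpos, hneg⟩ := exists_sign (hAs.sub hBs)
  have hX : IsSelfAdjoint (A * A - B * B) := by
    simp [IsSelfAdjoint, star_sub, star_mul, hAs.star_eq, hBs.star_eq]
  refine le_trans ?_ (trace_mul_re_le_traceNorm hX hU₁ hU₂)
  have h₁ := trace_mul_re_nonneg hpos hB
  have h₂ := trace_mul_re_nonneg hneg hA
  have hcyc : (U * ((A + B) * (A - B))).trace = (U * (A - B) * (A + B)).trace := by
    rw [← mul_assoc, trace_mul_cycle, hcomm]
  have hAB : (U * (A * A - B * B)).trace = (U * (A - B) * (A + B)).trace := by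
    have hsum : (2 : ℂ) * (U * (A * A - B * B)).trace =
        (U * (A - B) * (A + B)).trace + (U * ((A + B) * (A - B))).trace := by
      rw [← trace_add, two_mul, ← trace_add]
      congr 1
      noncomm_ring
    rw [hcyc, ← two_mul] at hsum
    exact mul_left_cancel₀ two_ne_zero hsum
  rw [hAB]
  simp only [mul_add, mul_sub, add_mul, sub_mul, trace_add, trace_sub,
    Complex.add_re, Complex.sub_re] at h₁ h₂ ⊢
  linarith

end PowersStormer

/-- Bhattacharyya bound. `1 − D(ρ,σ) ≤ Tr(√ρ √σ)`. -/
theorem bhattacharyya_bound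
    {n : ℕ} (ρ σ : Matrix (Fin n) (Fin n) ℂ)
    (hρ : ρ.PosSemidef) (hσ : σ.PosSemidef)
    (hτρ : ρ.trace = 1) (hτσ : σ.trace = 1) :
    1 - traceDist ρ σ ≤ ((CFC.sqrt ρ * CFC.sqrt σ).trace).re := by
  have h := trace_sub_sq_re_le_traceNorm (CFC.sqrt_nonneg ρ) (CFC.sqrt_nonneg σ)
  simp only [sub_mul, mul_sub] at h
  rw [CFC.sqrt_mul_sqrt_self ρ hρ.nonneg, CFC.sqrt_mul_sqrt_self σ hσ.nonneg] at h
  simp only [trace_sub, trace_mul_comm (CFC.sqrt σ), hτρ, hτσ, Complex.sub_re,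
    Complex.one_re] at h
  unfold traceDist
  linarith
end

section
/- Let ρ and σ be density matrices on ℂⁿ, and let ψ, φ ∈ ℂᵐ ⊗ ℂⁿ be purifications of ρ and σ respectively (unit vectors whose reduced states on the second tensor factor are ρ and σ). Then |⟨ψ,φ⟩|² ≤ F(ρ,σ), where F(ρ,σ) = (Tr √(√ρ σ √ρ))² is the fidelity. -/
open Matrix Complex Finset
open scoped ComplexOrder MatrixOrder

/-- The fidelity `F(ρ,σ) = (Tr √(√ρ σ √ρ))²`. -/
noncomputable def fidelity {n : ℕ} {ρ σ : Matrix (Fin n) (Fin n) ℂ}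
    (hρ : ρ.PosSemidef) (hσ : σ.PosSemidef) : ℝ :=
  (((CFC.sqrt (CFC.sqrt ρ * σ * CFC.sqrt ρ)).trace).re) ^ 2

/-- The Cauchy–Schwarz inequality for finite sums of products of complex numbers. -/
theorem norm_sum_mul_le_sqrt_mul_sqrt {m : Type*} [Fintype m] (f g : m → ℂ) :
    ‖∑ i, f i * g i‖ ≤ √(∑ i, ‖f i‖ ^ 2) * √(∑ i, ‖g i‖ ^ 2) :=
  calc ‖∑ i, f i * g i‖ ≤ ∑ i, ‖f i‖ * ‖g i‖ := by
        simpa only [norm_mul] using norm_sum_le univ fun i => f i * g i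
    _ ≤ _ := Real.sum_mul_le_sqrt_mul_sqrt univ _ _

namespace Matrix

variable {m n : Type*} [Fintype m]

theorem mul_conjTranspose_diag_re (M : Matrix n m ℂ) (k : n) :
    ((M * Mᴴ) k k).re = ∑ i, ‖M k i‖ ^ 2 := by
  simp [mul_apply, Complex.mul_conj, Complex.normSq_eq_norm_sq, -Complex.ofReal_pow]

theorem conjTranspose_mul_diag_re (M : Matrix m n ℂ) (k : n) :
    ((Mᴴ * M) k k).re = ∑ i, ‖M i k‖ ^ 2 := by
  simpa using mul_conjTranspose_diag_re Mᴴ k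

variable [Fintype n] [DecidableEq n]

/-- If `A Aᴴ = ρ`, then `Aᴴ` factors as a contraction times `√ρ`. -/
theorem exists_contraction_mul_sqrt (ρ : Matrix n n ℂ) (hρ : ρ.PosSemidef)
    (A : Matrix n m ℂ) (hA : A * Aᴴ = ρ) :
    ∃ W : Matrix m n ℂ, W * CFC.sqrt ρ = Aᴴ ∧ Wᴴ * W ≤ 1 := by
  have hcont : ∀ f : ℝ → ℝ, ContinuousOn f (spectrum ℝ ρ) := fun f =>
    (Matrix.finite_real_spectrum (A := ρ)).continuousOn f
  have hsa : IsSelfAdjoint ρ := hρ.isHermitian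
  have hnn : (0 : Matrix n n ℂ) ≤ ρ := hρ.nonneg
  have hspec : ∀ x ∈ spectrum ℝ ρ, 0 ≤ x := fun x hx => spectrum_nonneg_of_nonneg hnn hx
  set P : Matrix n n ℂ := cfc (fun x : ℝ => (√x)⁻¹) ρ with hP
  have hPH : Pᴴ = P := (cfc_predicate (fun x : ℝ => (√x)⁻¹) ρ : IsSelfAdjoint P)
  have hS : CFC.sqrt ρ = cfc Real.sqrt ρ := by
    rw [CFC.sqrt_eq_real_sqrt ρ hnn, cfcₙ_eq_cfc]
  have hid : ρ = cfc (fun x : ℝ => x) ρ := (cfc_id' ℝ ρ).symm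
  have hQ : 1 - P * CFC.sqrt ρ = cfc (fun x : ℝ => 1 - (√x)⁻¹ * √x) ρ := by
    rw [hS, hP, ← cfc_mul _ _ ρ (hcont _) (hcont _), cfc_sub _ _ ρ (hcont _) (hcont _),
      cfc_const_one ℝ ρ]
  refine ⟨Aᴴ * P, ?_, ?_⟩
  · set Q : Matrix n n ℂ := 1 - P * CFC.sqrt ρ with hQdef
    have hQH : Qᴴ = Q := by
      rw [hQ]; exact (cfc_predicate (fun x : ℝ => 1 - (√x)⁻¹ * √x) ρ : IsSelfAdjoint _)
    have hzero : (Aᴴ * Q)ᴴ * (Aᴴ * Q) = 0 := by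
      have hρQ : ρ * Q = 0 := by
        rw [hQ]
        nth_rewrite 1 [hid]
        rw [← cfc_mul _ _ ρ (hcont _) (hcont _), ← cfc_const_zero ℝ ρ]
        refine cfc_congr fun x hx => ?_
        rcases (hspec x hx).eq_or_lt with h | h
        · simp [← h]
        · simp [inv_mul_cancel₀ (Real.sqrt_pos.2 h).ne']
      rw [conjTranspose_mul, conjTranspose_conjTranspose, Matrix.mul_assoc,
        ← Matrix.mul_assoc A, hA, hρQ, Matrix.mul_zero]
    have h0 := conjTranspose_mul_self_eq_zero.1 hzero
    rw [hQdef, Matrix.mul_sub, Matrix.mul_one, sub_eq_zero] at h0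
    rw [Matrix.mul_assoc, ← h0]
  · have : (Aᴴ * P)ᴴ * (Aᴴ * P) = cfc (fun x : ℝ => (√x)⁻¹ * x * (√x)⁻¹) ρ := by
      rw [cfc_mul _ _ ρ (hcont _) (hcont _), cfc_mul _ _ ρ (hcont _) (hcont _), ← hid, ← hP,
        conjTranspose_mul, conjTranspose_conjTranspose, hPH, ← hA]
      simp only [Matrix.mul_assoc]
    rw [this]
    refine cfc_le_one _ ρ fun x hx => ?_
    rcases (hspec x hx).eq_or_lt with h | h
    · simp [← h]
    · have hx' := (Real.sqrt_pos.2 h).ne'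
      apply le_of_eq
      nth_rewrite 2 [← Real.mul_self_sqrt h.le]
      field_simp

/-- Pairing a matrix `M` with a contraction is bounded by the trace norm `Tr √(M Mᴴ)`. -/
theorem norm_trace_mul_contraction_le (M : Matrix n m ℂ) (W : Matrix m n ℂ)
    (hW : Wᴴ * W ≤ 1) :
    ‖(M * W).trace‖ ≤ (CFC.sqrt (M * Mᴴ)).trace.re := by
  set T := CFC.sqrt (M * Mᴴ)
  have hTpos : T.PosSemidef := (CFC.sqrt_nonneg (M * Mᴴ)).posSemidef
  have hTT : T * T = M * Mᴴ :=
    CFC.sqrt_mul_sqrt_self _ (posSemidef_self_mul_conjTranspose M).nonneg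
  have hH := hTpos.isHermitian
  set d := hH.eigenvalues with hd
  obtain ⟨V, hV⟩ : ∃ V : Matrix n n ℂ, V = ↑hH.eigenvectorUnitary := ⟨_, rfl⟩
  have hVV : Vᴴ * V = 1 := hV ▸ Unitary.coe_star_mul_self hH.eigenvectorUnitary
  have hVV' : V * Vᴴ = 1 := hV ▸ Unitary.coe_mul_star_self hH.eigenvectorUnitary
  have hspec : T = V * diagonal (fun k => (d k : ℂ)) * Vᴴ :=
    hV ▸ hH.spectral_theorem
  have hdiag : (Vᴴ * M) * (Vᴴ * M)ᴴ = diagonal (fun k => (d k : ℂ) * d k) := by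
    calc (Vᴴ * M) * (Vᴴ * M)ᴴ = Vᴴ * (T * T) * V := by
          rw [hTT, conjTranspose_mul, conjTranspose_conjTranspose]
          simp only [Matrix.mul_assoc]
      _ = (Vᴴ * V) * diagonal (fun k => (d k : ℂ)) * (Vᴴ * V) *
            diagonal (fun k => (d k : ℂ)) * (Vᴴ * V) := by
          rw [hspec]; simp only [Matrix.mul_assoc]
      _ = _ := by simp [hVV, diagonal_mul_diagonal]
  have hrow : ∀ k, √(∑ i, ‖(Vᴴ * M) k i‖ ^ 2) = d k := fun k => by
    rw [← mul_conjTranspose_diag_re, hdiag, diagonal_apply_eq, ← Complex.ofReal_mul,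
      Complex.ofReal_re, Real.sqrt_mul_self (hTpos.eigenvalues_nonneg k)]
  have hcol : ∀ k, √(∑ i, ‖(W * V) i k‖ ^ 2) ≤ 1 := fun k => by
    rw [← conjTranspose_mul_diag_re, Real.sqrt_le_one]
    have h := ((Matrix.le_iff.1 hW).conjTranspose_mul_mul_same V).diag_nonneg (i := k)
    have heq : Vᴴ * (1 - Wᴴ * W) * V = 1 - (W * V)ᴴ * (W * V) := by
      rw [Matrix.mul_sub, Matrix.sub_mul, Matrix.mul_one, hVV, conjTranspose_mul]
      simp only [Matrix.mul_assoc]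
    rw [heq, sub_apply, one_apply_eq] at h
    simpa using (Complex.le_def.1 h).1
  have htrace : (M * W).trace = ∑ k, ∑ i, (Vᴴ * M) k i * (W * V) i k := by
    calc (M * W).trace = ((M * W) * (V * Vᴴ)).trace := by rw [hVV', Matrix.mul_one]
      _ = ((Vᴴ * M) * (W * V)).trace := by
          rw [← Matrix.mul_assoc, trace_mul_comm]
          simp only [Matrix.mul_assoc]
      _ = _ := by simp only [trace, diag_apply, mul_apply]
  have hTtrace : T.trace.re = ∑ k, d k := by
    rw [hH.trace_eq_sum_eigenvalues]
    simp [hd]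
  rw [htrace, hTtrace]
  refine (norm_sum_le _ _).trans (sum_le_sum fun k _ => ?_)
  calc _ ≤ _ := norm_sum_mul_le_sqrt_mul_sqrt _ _
    _ ≤ d k * 1 := by
        rw [hrow]
        exact mul_le_mul_of_nonneg_left (hcol k) (hTpos.eigenvalues_nonneg k)
    _ = d k := mul_one _

end Matrix

/-- Uhlmann upper bound. For any purifications `ψ` of `ρ` and
`φ` of `σ`, `|⟨ψ,φ⟩|² ≤ F(ρ,σ)`. -/
theorem sq_abs_inner_le_fidelity
    {m n : ℕ} (ρ σ : Matrix (Fin n) (Fin n) ℂ)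
    (hρ : ρ.PosSemidef) (hσ : σ.PosSemidef)
    (hτρ : ρ.trace = 1) (hτσ : σ.trace = 1)
    (ψ φ : Fin m → Fin n → ℂ)
    (hψu : ∑ i, ∑ j, star (ψ i j) * ψ i j = 1)
    (hφu : ∑ i, ∑ j, star (φ i j) * φ i j = 1)
    (hψred : ∀ j j', (∑ i, ψ i j * star (ψ i j')) = ρ j j')
    (hφred : ∀ j j', (∑ i, φ i j * star (φ i j')) = σ j j') :
    ‖∑ i, ∑ j, star (ψ i j) * φ i j‖ ^ 2 ≤ fidelity hρ hσ := by
  set A : Matrix (Fin n) (Fin m) ℂ := of fun j i => ψ i j with hAdef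
  set B : Matrix (Fin n) (Fin m) ℂ := of fun j i => φ i j with hBdef
  have hA : A * Aᴴ = ρ := by
    ext j j'
    simpa [mul_apply, hAdef] using hψred j j'
  have hB : B * Bᴴ = σ := by
    ext j j'
    simpa [mul_apply, hBdef] using hφred j j'
  obtain ⟨W, hWS, hW⟩ := exists_contraction_mul_sqrt ρ hρ A hA
  have hSH : (CFC.sqrt ρ)ᴴ = CFC.sqrt ρ := (CFC.sqrt_nonneg ρ).posSemidef.isHermitian
  have hM : (CFC.sqrt ρ * B) * (CFC.sqrt ρ * B)ᴴ = CFC.sqrt ρ * σ * CFC.sqrt ρ := by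
    rw [conjTranspose_mul, hSH, ← hB]
    simp only [Matrix.mul_assoc]
  have hinner : ∑ i, ∑ j, star (ψ i j) * φ i j = (CFC.sqrt ρ * B * W).trace := by
    rw [trace_mul_comm, ← Matrix.mul_assoc, hWS]
    simp [trace, mul_apply, hAdef, hBdef]
  rw [hinner, fidelity, ← hM]
  exact pow_le_pow_left₀ (norm_nonneg _) (norm_trace_mul_contraction_le _ W hW) 2
end
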